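/- Suppose -VU = G_1⋯G_r where each G_i is a conjugate of U in SL(2,ℤ). Then r ≥ 8, and a finite sequence of Hurwitz moves transforms the sequence (G_1,…,G_r) into a sequence (V, U, D_3,…,D_r) with D_3⋯D_r = -Id (minus the 2×2 identity matrix). -/

import Mathlib

/-- `SL(2,ℤ)`, the group of 2×2 integer matrices of determinant 1. -/
abbrev SL2Z := Matrix.SpecialLinearGroup (Fin 2) ℤ

instance : Fact (Even (Fintype.card (Fin 2))) := ⟨by simp⟩

/-- The matrix `U = [[1,1],[0,1]]`. -/
def U : SL2Z := ⟨!![1, 1; 0, 1], by norm_num [Matrix.det_fin_two_of]⟩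

/-- The matrix `V = [[1,0],[-1,1]]`. -/
def V : SL2Z := ⟨!![1, 0; -1, 1], by norm_num [Matrix.det_fin_two_of]⟩

/-- A single Hurwitz move on a finite sequence of elements of a group: some consecutive
pair `(a, b)` is replaced by `(b, b⁻¹ * a * b)` or by `(a * b * a⁻¹, a)`. -/
def HurwitzMove {G : Type*} [Group G] (L L' : List G) : Prop :=
  ∃ (p : List G) (a b : G) (t : List G),
    L = p ++ a :: b :: t ∧
    (L' = p ++ b :: (b⁻¹ * a * b) :: t ∨ L' = p ++ (a * b * a⁻¹) :: a :: t)

/-- A finite sequence of Hurwitz moves. -/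
def HurwitzEquiv {G : Type*} [Group G] : List G → List G → Prop :=
  Relation.ReflTransGen HurwitzMove

namespace HurwitzMove

variable {G : Type*} [Group G]

theorem cons {L L' : List G} (c : G) (h : HurwitzMove L L') : HurwitzMove (c :: L) (c :: L') := by
  obtain ⟨p, a, b, t, rfl, rfl | rfl⟩ := h
  · exact ⟨c :: p, a, b, t, rfl, Or.inl rfl⟩
  · exact ⟨c :: p, a, b, t, rfl, Or.inr rfl⟩

theorem prod_eq {L L' : List G} (h : HurwitzMove L L') : L'.prod = L.prod := by
  obtain ⟨p, a, b, t, rfl, rfl | rfl⟩ := h <;> simp [mul_assoc]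

theorem length_eq {L L' : List G} (h : HurwitzMove L L') : L'.length = L.length := by
  obtain ⟨p, a, b, t, rfl, rfl | rfl⟩ := h <;> simp

theorem forall_isConj {L L' : List G} {g : G} (h : HurwitzMove L L')
    (hL : ∀ A ∈ L, IsConj g A) : ∀ A ∈ L', IsConj g A := by
  obtain ⟨p, a, b, t, rfl, h⟩ := h
  have ha : IsConj g a := hL a (by simp)
  have hb : IsConj g b := hL b (by simp)
  have hab : IsConj g (b⁻¹ * a * b) := ha.trans (isConj_iff.2 ⟨b⁻¹, by simp⟩)
  have hba : IsConj g (a * b * a⁻¹) := hb.trans (isConj_iff.2 ⟨a, rfl⟩)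
  rcases h with rfl | rfl <;> intro A hA <;>
    simp only [List.mem_append, List.mem_cons] at hA <;>
    rcases hA with hA | rfl | rfl | hA <;>
    first | assumption | exact hL A (by simp [hA])

end HurwitzMove

namespace HurwitzEquiv

variable {G : Type*} [Group G]

theorem refl (L : List G) : HurwitzEquiv L L := Relation.ReflTransGen.refl

theorem trans {L L' L'' : List G} (h : HurwitzEquiv L L') (h' : HurwitzEquiv L' L'') :
    HurwitzEquiv L L'' := Relation.ReflTransGen.trans h h'

theorem cons {L L' : List G} (c : G) (h : HurwitzEquiv L L') :
    HurwitzEquiv (c :: L) (c :: L') :=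
  Relation.ReflTransGen.lift (c :: ·) (fun _ _ => HurwitzMove.cons c) _ _ h

theorem append_left {L L' : List G} (p : List G) (h : HurwitzEquiv L L') :
    HurwitzEquiv (p ++ L) (p ++ L') := by
  induction p with
  | nil => exact h
  | cons c p ih => exact ih.cons c

theorem prod_eq {L L' : List G} (h : HurwitzEquiv L L') : L'.prod = L.prod := by
  induction h with
  | refl => rfl
  | tail _ h ih => rw [h.prod_eq, ih]

theorem length_eq {L L' : List G} (h : HurwitzEquiv L L') : L'.length = L.length := by
  induction h with
  | refl => rfl
  | tail _ h ih => rw [h.length_eq, ih]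

theorem forall_isConj {L L' : List G} {g : G} (h : HurwitzEquiv L L')
    (hL : ∀ A ∈ L, IsConj g A) : ∀ A ∈ L', IsConj g A := by
  induction h with
  | refl => exact hL
  | tail _ h ih => exact h.forall_isConj ih

theorem swap_left (a b : G) (t : List G) : HurwitzEquiv (a :: b :: t) (b :: (b⁻¹ * a * b) :: t) :=
  Relation.ReflTransGen.single ⟨[], a, b, t, rfl, Or.inl rfl⟩

theorem swap_right (a b : G) (t : List G) :
    HurwitzEquiv (a :: b :: t) ((a * b * a⁻¹) :: a :: t) :=
  Relation.ReflTransGen.single ⟨[], a, b, t, rfl, Or.inr rfl⟩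

/-- Any two consecutive entries can be moved unchanged to the front. -/
theorem exists_pair_to_front (p : List G) (a b : G) (t : List G) :
    ∃ D, HurwitzEquiv (p ++ a :: b :: t) (a :: b :: D) := by
  induction p with
  | nil => exact ⟨t, refl _⟩
  | cons c p ih =>
    obtain ⟨D, hD⟩ := ih
    exact ⟨_, ((hD.cons c).trans (swap_left c a _)).trans ((swap_left _ b _).cons a)⟩

end HurwitzEquiv

/-- An element of order three; up to sign it is `V * U`. -/
def thirdTurn : SL2Z := -(V * U)

/-- An element whose square is `-1`. -/
def quarterTurn : SL2Z := U * V * U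

theorem thirdTurn_pow_three : thirdTurn ^ 3 = 1 := by decide

theorem quarterTurn_mul_self : quarterTurn * quarterTurn = -1 := by decide

theorem U_eq : U = -(quarterTurn * thirdTurn⁻¹) := by decide

theorem quarterTurn_inv : quarterTurn⁻¹ = -quarterTurn := by decide

theorem quarterTurn_mul_cancel (x : SL2Z) : quarterTurn * (quarterTurn * x) = -x := by
  rw [← mul_assoc, quarterTurn_mul_self, neg_one_mul]

theorem thirdTurn_zpow_congr {i j : ℤ} (h : 3 ∣ i - j) : thirdTurn ^ i = thirdTurn ^ j := by
  obtain ⟨k, hk⟩ := h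
  have h3 : thirdTurn ^ (3 : ℤ) = 1 := by exact_mod_cast thirdTurn_pow_three
  rw [show i = j + 3 * k by omega, zpow_add, zpow_mul, h3, one_zpow, mul_one]

/-- The first column of `x` lies in the half-open sector `x * y > 0 ∨ y = 0` of the plane. -/
def InSector (x : SL2Z) : Prop := 0 < x 0 0 * x 1 0 ∨ x 1 0 = 0

theorem inSector_neg (x : SL2Z) : InSector (-x) ↔ InSector x := by
  simp [InSector]

theorem inSector_one : InSector 1 := by simp [InSector]

theorem quarterTurn_coe : (quarterTurn : Matrix (Fin 2) (Fin 2) ℤ) = !![0, 1; -1, 0] := by decide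

theorem thirdTurn_coe : (thirdTurn : Matrix (Fin 2) (Fin 2) ℤ) = !![-1, -1; 1, 0] := by decide

theorem inSector_quarterTurn_mul (x : SL2Z) : InSector (quarterTurn * x) ↔ ¬InSector x := by
  have hdet := x.det_coe
  rw [Matrix.det_fin_two] at hdet
  have h0 : (quarterTurn * x) 0 0 = x 1 0 := by
    simp [quarterTurn_coe, Matrix.mul_apply, Fin.sum_univ_two]
  have h1 : (quarterTurn * x) 1 0 = -x 0 0 := by
    simp [quarterTurn_coe, Matrix.mul_apply, Fin.sum_univ_two]
  rw [InSector, InSector, h0, h1]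
  generalize x 0 0 = a at *
  generalize x 1 0 = c at *
  constructor
  · rintro (h | h) (h' | h')
    · nlinarith
    · simp [h'] at h
    · simp [neg_eq_zero.1 h] at h'
    · simp [neg_eq_zero.1 h, h'] at hdet
  · intro h
    push Not at h
    rcases eq_or_ne a 0 with ha | ha
    · simp [ha]
    · left
      have : a * c ≠ 0 := mul_ne_zero ha h.2
      have := lt_of_le_of_ne h.1 this
      nlinarith

theorem not_inSector_thirdTurn_mul {x : SL2Z} (hx : InSector x) : ¬InSector (thirdTurn * x) := by
  have hdet := x.det_coe
  rw [Matrix.det_fin_two] at hdet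
  have h0 : (thirdTurn * x) 0 0 = -(x 0 0 + x 1 0) := by
    simp [thirdTurn_coe, Matrix.mul_apply, Fin.sum_univ_two]
    ring
  have h1 : (thirdTurn * x) 1 0 = x 0 0 := by
    simp [thirdTurn_coe, Matrix.mul_apply, Fin.sum_univ_two]
  rw [InSector] at hx ⊢
  rw [h0, h1]
  generalize x 0 0 = a at *
  generalize x 1 0 = c at *
  rintro (h | h)
  · rcases hx with hx | rfl <;> nlinarith [sq_nonneg a]
  · rcases hx with hx | rfl <;> simp [h] at *

theorem not_inSector_thirdTurn_inv_mul {x : SL2Z} (hx : InSector x) :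
    ¬InSector (thirdTurn⁻¹ * x) := fun h =>
  not_inSector_thirdTurn_mul h (by simpa using hx)

/-- The three sectors obtained by turning the basic one are disjoint. -/
theorem dvd_sub_of_inSector {i j : ℤ} {x : SL2Z} (hi : InSector (thirdTurn ^ (-i) * x))
    (hj : InSector (thirdTurn ^ (-j) * x)) : 3 ∣ i - j := by
  by_contra hij
  have key : thirdTurn ^ (-j) * x = thirdTurn ^ (i - j) * (thirdTurn ^ (-i) * x) := by
    rw [← mul_assoc, ← zpow_add]; congr 2; ring
  rw [key] at hj
  obtain h | h : 3 ∣ (i - j) - 1 ∨ 3 ∣ (i - j) - (-1) := by omega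
  · rw [thirdTurn_zpow_congr h, zpow_one] at hj
    exact not_inSector_thirdTurn_mul hi hj
  · rw [thirdTurn_zpow_congr h, zpow_neg_one] at hj
    exact not_inSector_thirdTurn_inv_mul hi hj

/-- The conjugate of `U` by `M`. -/
def conjU (M : SL2Z) : SL2Z := M * U * M⁻¹

theorem conjU_neg (M : SL2Z) : conjU (-M) = conjU M := by
  simp [conjU]

theorem conj_conjU (g M : SL2Z) : g * conjU M * g⁻¹ = conjU (g * M) := by
  simp [conjU, mul_assoc]

theorem conj_inv_conjU (g M : SL2Z) : g⁻¹ * conjU M * g = conjU (g⁻¹ * M) := by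
  simp [conjU, mul_assoc]

/-- The value of the word `thirdTurn ^ i₀ * quarterTurn * ⋯ * quarterTurn * thirdTurn ^ iₖ`, with
first exponent `i` and remaining exponents listed. -/
def wordValue : ℤ → List ℤ → SL2Z
  | i, [] => thirdTurn ^ i
  | i, j :: a => thirdTurn ^ i * quarterTurn * wordValue j a

theorem thirdTurn_zpow_mul_wordValue (k i : ℤ) (a : List ℤ) :
    thirdTurn ^ k * wordValue i a = wordValue (k + i) a := by
  cases a <;> simp [wordValue, zpow_add, mul_assoc]

theorem exists_conjU_wordValue (c : SL2Z) : ∃ i a, conjU (wordValue i a) = conjU c := by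
  have hc : c ∈ Subgroup.closure {ModularGroup.S, ModularGroup.T} := by
    rw [SpecialLinearGroup.SL2Z_generators]; trivial
  have hS : ModularGroup.S = -quarterTurn := by decide
  have hT : ModularGroup.T = -(quarterTurn * thirdTurn ^ (-1 : ℤ)) := by decide
  have hT' : (ModularGroup.T)⁻¹ = thirdTurn ^ (1 : ℤ) * quarterTurn := by decide
  induction hc using Subgroup.closure_induction_left with
  | one => exact ⟨0, [], by simp [wordValue]⟩
  | mul_left x hx y _ ih =>
    obtain ⟨i, a, h⟩ := ih
    rw [← conj_conjU, ← h]
    rcases hx with rfl | rfl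
    · exact ⟨0, i :: a, by rw [conj_conjU, hS, neg_mul, conjU_neg]; simp [wordValue]⟩
    · refine ⟨0, (-1 + i) :: a, ?_⟩
      rw [conj_conjU, hT, neg_mul, conjU_neg, mul_assoc, thirdTurn_zpow_mul_wordValue]
      simp [wordValue]
  | inv_mul_cancel x hx y _ ih =>
    obtain ⟨i, a, h⟩ := ih
    rw [← conj_conjU, ← h]
    rcases hx with rfl | rfl
    · refine ⟨0, i :: a, ?_⟩
      rw [conj_conjU, hS, _root_.inv_neg, quarterTurn_inv, neg_neg]; simp [wordValue]
    · exact ⟨1, i :: a, by rw [conj_conjU, hT']; rfl⟩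

/-- `A` is the conjugate of `U` by a word with fewer than `n` factors `quarterTurn`. -/
def IsShort (A : SL2Z) (n : ℕ) : Prop :=
  ∃ i a, a.length < n ∧ conjU (wordValue i a) = A

theorem IsShort.prepend {A : SL2Z} {n : ℕ} (h : IsShort A n) (i : ℤ) :
    IsShort (thirdTurn ^ i * quarterTurn * A * (thirdTurn ^ i * quarterTurn)⁻¹) (n + 1) := by
  obtain ⟨j, a, ha, rfl⟩ := h
  exact ⟨i, j :: a, by simpa using ha, by rw [conj_conjU]; rfl⟩

theorem conjU_wordValue_cons (i j : ℤ) (a : List ℤ) :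
    conjU (wordValue i (j :: a)) = thirdTurn ^ i * quarterTurn * conjU (wordValue j a) *
      (thirdTurn ^ i * quarterTurn)⁻¹ := by
  rw [conj_conjU]; rfl

theorem conjU_quarterTurn : conjU quarterTurn = conjU (thirdTurn ^ (2 : ℤ)) := by decide

theorem conjU_quarterTurn_mul_thirdTurn_sq :
    conjU (quarterTurn * thirdTurn ^ (2 : ℤ)) = conjU 1 := by decide

theorem conjU_mul_congr {M N : SL2Z} (g : SL2Z) (h : conjU M = conjU N) :
    conjU (g * M) = conjU (g * N) := by
  rw [← conj_conjU, h, conj_conjU]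

theorem dvd_sub_one_of_not_isShort {i j : ℤ} (h : ¬IsShort (conjU (wordValue i [j])) 1) :
    3 ∣ j - 1 := by
  by_contra hj
  apply h
  obtain hj | hj : 3 ∣ j - 0 ∨ 3 ∣ j - 2 := by omega
  · refine ⟨i + 2, [], by simp, ?_⟩
    simp only [wordValue, thirdTurn_zpow_congr hj, zpow_zero, mul_one, zpow_add]
    exact conjU_mul_congr _ conjU_quarterTurn.symm
  · refine ⟨i, [], by simp, ?_⟩
    simp only [wordValue, thirdTurn_zpow_congr hj, mul_assoc]
    rw [conjU_mul_congr _ conjU_quarterTurn_mul_thirdTurn_sq, mul_one]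

/-- If a nontrivial word cannot be shortened, then the cones of the corresponding conjugate
of `U` and of its inverse lie in the sector given by the first exponent. -/
theorem inSector_of_not_isShort (i j : ℤ) (a : List ℤ)
    (h : ¬IsShort (conjU (wordValue i (j :: a))) (j :: a).length) (x : SL2Z)
    (hx : InSector ((wordValue i (j :: a))⁻¹ * x) ∨
      InSector (thirdTurn⁻¹ * ((wordValue i (j :: a))⁻¹ * x))) :
    InSector (thirdTurn ^ (-i) * x) := by
  induction a generalizing i j x with
  | nil =>
    have h1 := dvd_sub_one_of_not_isShort h
    simp only [wordValue, thirdTurn_zpow_congr h1, zpow_one, mul_inv_rev, quarterTurn_inv,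
      mul_neg, neg_mul, inSector_neg, ← zpow_neg, mul_assoc] at hx
    rcases hx with hx | hx
    · have := not_inSector_thirdTurn_mul hx
      rwa [mul_inv_cancel_left, inSector_quarterTurn_mul, not_not] at this
    · have := not_inSector_thirdTurn_inv_mul hx
      rw [← mul_assoc, ← mul_assoc, show thirdTurn⁻¹ * thirdTurn⁻¹ * thirdTurn⁻¹ = 1 by decide,
        one_mul, inSector_quarterTurn_mul, not_not] at this
      exact this
  | cons k a ih =>
    have hj : ¬3 ∣ j - 0 := by
      intro hj
      refine h ⟨i + k, a, by simp, ?_⟩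
      rw [← thirdTurn_zpow_mul_wordValue, ← conjU_neg]
      simp [wordValue, thirdTurn_zpow_congr hj, mul_assoc, quarterTurn_mul_cancel]
    have h' : ¬IsShort (conjU (wordValue j (k :: a))) (k :: a).length := by
      intro hs
      rw [conjU_wordValue_cons] at h
      exact h (hs.prepend i)
    rw [wordValue] at hx
    simp only [mul_inv_rev, quarterTurn_inv, mul_neg, neg_mul, inSector_neg, ← zpow_neg,
      mul_assoc] at hx
    have := ih j k h' _ hx
    by_contra h0
    rw [← inSector_quarterTurn_mul] at h0
    exact hj (dvd_sub_of_inSector this (j := 0) (by simpa using h0))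

/-- The cones of `B` and of the inverse of `A` are disjoint, where `A` and `B` are the conjugates
of `U` by the words `w` and `w'`. -/
def ConesDisjoint (w w' : ℤ × List ℤ) : Prop :=
  ∀ x, InSector ((wordValue w'.1 w'.2)⁻¹ * x) →
    ¬InSector (thirdTurn⁻¹ * ((wordValue w.1 w.2)⁻¹ * x))

theorem thirdTurn_inv_mul_zpow (i : ℤ) (x : SL2Z) :
    thirdTurn⁻¹ * (thirdTurn ^ (-i) * x) = thirdTurn ^ (-(i + 1)) * x := by
  rw [← mul_assoc, ← zpow_neg_one, ← zpow_add]; congr 2; ring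

/-- Two words with intersecting cones can be shortened, possibly after a Hurwitz move,
unless both are powers of `thirdTurn`, with consecutive exponents modulo three. -/
theorem isShort_of_not_conesDisjoint (i j : ℤ) (a b : List ℤ)
    (h : ¬ConesDisjoint (i, a) (j, b))
    (ha : ¬IsShort (conjU (wordValue i a)) a.length)
    (hb : ¬IsShort (conjU (wordValue j b)) b.length) :
    IsShort (conjU (wordValue i a) * conjU (wordValue j b) * (conjU (wordValue i a))⁻¹) b.length ∨
    IsShort ((conjU (wordValue j b))⁻¹ * conjU (wordValue i a) * conjU (wordValue j b)) a.length ∨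
    (a = [] ∧ b = [] ∧ 3 ∣ i + 1 - j) := by
  induction a generalizing i j b with
  | nil =>
    simp only [ConesDisjoint, not_forall, not_not] at h
    obtain ⟨x, hx, hx'⟩ := h
    simp only [wordValue, ← zpow_neg, thirdTurn_inv_mul_zpow] at hx'
    rcases b with - | ⟨j', b⟩
    · simp only [wordValue, ← zpow_neg] at hx
      exact Or.inr (Or.inr ⟨rfl, rfl, dvd_sub_of_inSector hx' hx⟩)
    · have hj := inSector_of_not_isShort _ _ _ hb x (Or.inl hx)
      have hd := dvd_sub_of_inSector hj hx'
      refine Or.inl ⟨i + j', b, by simp, ?_⟩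
      rw [conj_conjU, ← thirdTurn_zpow_mul_wordValue, wordValue, wordValue,
        thirdTurn_zpow_congr hd]
      simp [conjU, U_eq, mul_assoc, zpow_add, quarterTurn_mul_cancel]
  | cons i' a ih =>
    simp only [ConesDisjoint, not_forall, not_not] at h
    obtain ⟨x, hx, hx'⟩ := h
    have hi := inSector_of_not_isShort _ _ _ ha x (Or.inr hx')
    rcases b with - | ⟨j', b⟩
    · simp only [wordValue, ← zpow_neg] at hx
      have hd := dvd_sub_of_inSector hi hx
      refine Or.inr (Or.inl ⟨j + 1 + i', a, by simp, ?_⟩)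
      rw [conj_inv_conjU, ← thirdTurn_zpow_mul_wordValue, wordValue, wordValue,
        thirdTurn_zpow_congr hd]
      simp [conjU, U_eq, mul_assoc, zpow_add, quarterTurn_inv, quarterTurn_mul_cancel]
    · have hj := inSector_of_not_isShort _ _ _ hb x (Or.inl hx)
      have hd := thirdTurn_zpow_congr (dvd_sub_of_inSector hi hj)
      have hwb : wordValue j (j' :: b) = wordValue i (j' :: b) := by
        rw [wordValue, wordValue, hd]
      rw [hwb] at hx hb ⊢
      have ha' : ¬IsShort (conjU (wordValue i' a)) a.length := fun hs =>
        ha (by rw [conjU_wordValue_cons]; exact hs.prepend i)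
      have hb' : ¬IsShort (conjU (wordValue j' b)) b.length := fun hs =>
        hb (by rw [conjU_wordValue_cons]; exact hs.prepend i)
      have hdis : ¬ConesDisjoint (i', a) (j', b) := fun hdis =>
        hdis ((thirdTurn ^ i * quarterTurn)⁻¹ * x)
          (by simpa [wordValue, mul_assoc] using hx) (by simpa [wordValue, mul_assoc] using hx')
      rcases ih i' j' b hdis ha' hb' with hs | hs | ⟨rfl, rfl, hij⟩
      · left
        have := hs.prepend i
        simpa [conjU_wordValue_cons, mul_assoc] using this
      · right; left
        have := hs.prepend i
        simpa [conjU_wordValue_cons, mul_assoc] using this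
      · have := dvd_sub_one_of_not_isShort ha
        have := dvd_sub_one_of_not_isShort hb
        omega

theorem conesDisjoint_prod (w : ℤ × List ℤ) (l : List (ℤ × List ℤ))
    (h : (w :: l).IsChain ConesDisjoint) :
    ∃ w' ∈ w :: l, ∀ x, ¬InSector (thirdTurn⁻¹ * ((wordValue w'.1 w'.2)⁻¹ * x)) →
      InSector ((wordValue w.1 w.2)⁻¹ *
        (((w :: l).map fun w => conjU (wordValue w.1 w.2)).prod * x)) := by
  have step : ∀ M x : SL2Z, ¬InSector (thirdTurn⁻¹ * (M⁻¹ * x)) →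
      InSector (M⁻¹ * (conjU M * x)) := by
    intro M x hx
    have : M⁻¹ * (conjU M * x) = -(quarterTurn * (thirdTurn⁻¹ * (M⁻¹ * x))) := by
      simp [conjU, U_eq, mul_assoc]
    rwa [this, inSector_neg, inSector_quarterTurn_mul]
  induction l generalizing w with
  | nil => exact ⟨w, by simp, fun x hx => by simpa using step _ x hx⟩
  | cons v l ih =>
    rw [List.isChain_cons_cons] at h
    obtain ⟨w', hw', H⟩ := ih v h.2
    refine ⟨w', List.mem_cons_of_mem _ hw', fun x hx => ?_⟩
    rw [List.map_cons, List.prod_cons, mul_assoc]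
    exact step _ _ (h.1 _ (H x hx))

/-- A product of conjugates of `U` by words that cannot be shortened, with consecutive cones
disjoint, is not a power of `thirdTurn` up to sign. -/
theorem not_isChain_conesDisjoint {l : List (ℤ × List ℤ)} (hl : l ≠ [])
    (hs : ∀ w ∈ l, ¬IsShort (conjU (wordValue w.1 w.2)) w.2.length) {m : ℤ}
    (hm : (l.map fun w => conjU (wordValue w.1 w.2)).prod = thirdTurn ^ m ∨
      (l.map fun w => conjU (wordValue w.1 w.2)).prod = -thirdTurn ^ m) :
    ¬l.IsChain ConesDisjoint := by
  intro h
  obtain ⟨w, l, rfl⟩ := List.exists_cons_of_ne_nil hl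
  obtain ⟨w', hw', H⟩ := conesDisjoint_prod w l h
  have hfirst : ∀ x, InSector ((wordValue w.1 w.2)⁻¹ * x) →
      InSector (thirdTurn ^ (-w.1) * x) := by
    intro x hx
    have := hs w (by simp)
    obtain ⟨i, a⟩ := w
    cases a with
    | nil => simpa [wordValue] using hx
    | cons j a => exact inSector_of_not_isShort _ _ _ this x (Or.inl hx)
  obtain ⟨n, hn⟩ : ∃ n : ℤ, ∀ x, InSector (thirdTurn⁻¹ * ((wordValue w'.1 w'.2)⁻¹ * x)) →
      InSector (thirdTurn ^ (-n) * x) := by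
    have := hs w' hw'
    obtain ⟨i, a⟩ := w'
    cases a with
    | nil =>
      refine ⟨i + 1, fun x hx => ?_⟩
      rwa [wordValue, ← zpow_neg, thirdTurn_inv_mul_zpow] at hx
    | cons j a => exact ⟨i, fun x hx => inSector_of_not_isShort _ _ _ this x (Or.inr hx)⟩
  have hself : ∀ k : ℤ, InSector (thirdTurn ^ (-k) * thirdTurn ^ k) := by
    intro k
    rw [← zpow_add, neg_add_cancel, zpow_zero]
    exact inSector_one
  have hk : ∀ k : ℤ, ¬3 ∣ n - k → 3 ∣ w.1 - (m + k) := by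
    intro k hk
    have h1 := hfirst _ (H (thirdTurn ^ k) fun hx => hk (dvd_sub_of_inSector (hn _ hx) (hself k)))
    refine dvd_sub_of_inSector (x := thirdTurn ^ (m + k)) ?_ (hself _)
    rcases hm with hm | hm <;> rw [hm] at h1
    · rwa [← zpow_add] at h1
    · rwa [neg_mul, mul_neg, inSector_neg, ← zpow_add] at h1
  have := hk (n + 1) (by omega)
  have := hk (n + 2) (by omega)
  omega

/-- The pairs of short conjugates of `U` with product `V * U` are Hurwitz equivalent. -/
theorem hurwitzEquiv_V_U {i j : ℤ} (h : 3 ∣ i + 1 - j) (t : List SL2Z) :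
    HurwitzEquiv (conjU (thirdTurn ^ i) :: conjU (thirdTurn ^ j) :: t) (V :: U :: t) := by
  obtain hi | hi | hi : 3 ∣ i - 0 ∨ 3 ∣ i - 1 ∨ 3 ∣ i - 2 := by omega
  · rw [thirdTurn_zpow_congr hi, thirdTurn_zpow_congr (show 3 ∣ j - 1 by omega)]
    convert HurwitzEquiv.swap_right _ _ t using 2 <;> first | decide | (congr 1; decide)
  · rw [thirdTurn_zpow_congr hi, thirdTurn_zpow_congr (show 3 ∣ j - 2 by omega)]
    convert HurwitzEquiv.swap_left _ _ t using 2 <;> congr 1 <;> decide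
  · rw [thirdTurn_zpow_congr hi, thirdTurn_zpow_congr (show 3 ∣ j - 0 by omega)]
    convert HurwitzEquiv.refl (V :: U :: t) using 2 <;> congr 1 <;> decide

theorem exists_hurwitzEquiv_V_U_words (l : List (ℤ × List ℤ)) (hl : l ≠ []) (m : ℤ)
    (hm : (l.map fun w => conjU (wordValue w.1 w.2)).prod = thirdTurn ^ m ∨
      (l.map fun w => conjU (wordValue w.1 w.2)).prod = -thirdTurn ^ m) :
    ∃ D, HurwitzEquiv (l.map fun w => conjU (wordValue w.1 w.2)) (V :: U :: D) := by
  induction hN : (l.map fun w => w.2.length).sum using Nat.strong_induction_on generalizing l with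
  | _ N ih =>
  have shorten : ∀ l' : List (ℤ × List ℤ), (l'.map fun w => w.2.length).sum < N →
      HurwitzEquiv (l.map fun w => conjU (wordValue w.1 w.2))
        (l'.map fun w => conjU (wordValue w.1 w.2)) →
      ∃ D, HurwitzEquiv (l.map fun w => conjU (wordValue w.1 w.2)) (V :: U :: D) := by
    intro l' hlt hE
    have hl' : l' ≠ [] := by
      rintro rfl
      exact hl (by simpa using hE.length_eq.symm)
    rw [← hE.prod_eq] at hm
    obtain ⟨D, hD⟩ := ih _ hlt l' hl' hm rfl
    exact ⟨D, hE.trans hD⟩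
  by_cases hs : ∀ w ∈ l, ¬IsShort (conjU (wordValue w.1 w.2)) w.2.length
  · have hc := not_isChain_conesDisjoint hl hs hm
    rw [List.isChain_iff_forall_rel_of_append_cons_cons] at hc
    push Not at hc
    obtain ⟨⟨i, a⟩, ⟨j, b⟩, p, t, rfl, hc⟩ := hc
    rcases isShort_of_not_conesDisjoint i j a b hc (hs (i, a) (by simp)) (hs (j, b) (by simp)) with
      ⟨k, c, hlt, hk⟩ | ⟨k, c, hlt, hk⟩ | ⟨rfl, rfl, hij⟩
    · refine shorten (p ++ (k, c) :: (i, a) :: t) ?_ ?_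
      · simp at hN ⊢; omega
      · simp only [List.map_append, List.map_cons, hk]
        exact (HurwitzEquiv.swap_right _ _ _).append_left _
    · refine shorten (p ++ (j, b) :: (k, c) :: t) ?_ ?_
      · simp at hN ⊢; omega
      · simp only [List.map_append, List.map_cons, hk]
        exact (HurwitzEquiv.swap_left _ _ _).append_left _
    · simp only [List.map_append, List.map_cons, wordValue]
      obtain ⟨D, hD⟩ := HurwitzEquiv.exists_pair_to_front
        (p.map fun w => conjU (wordValue w.1 w.2)) V U
        (t.map fun w => conjU (wordValue w.1 w.2))
      exact ⟨D, ((hurwitzEquiv_V_U hij _).append_left _).trans hD⟩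
  · push Not at hs
    obtain ⟨⟨i, a⟩, hw, k, c, hlt, hk⟩ := hs
    obtain ⟨p, t, rfl⟩ := List.append_of_mem hw
    refine shorten (p ++ (k, c) :: t) ?_ ?_
    · simp at hN hlt ⊢; omega
    · simp only [List.map_append, List.map_cons, hk]
      exact HurwitzEquiv.refl _

/-- A nonempty factorization, into conjugates of `U`, of a power of `thirdTurn` or its negative
can be brought by Hurwitz moves to one starting with `V, U`. -/
theorem exists_hurwitzEquiv_V_U {L : List SL2Z} (hL : L ≠ []) (hconj : ∀ A ∈ L, IsConj U A) {m : ℤ}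
    (hm : L.prod = thirdTurn ^ m ∨ L.prod = -thirdTurn ^ m) :
    ∃ D : List SL2Z, HurwitzEquiv L (V :: U :: D) ∧ (∀ A ∈ D, IsConj U A) ∧
      D.prod = (V * U)⁻¹ * L.prod ∧ L.length = D.length + 2 := by
  obtain ⟨l, rfl⟩ : ∃ l : List (ℤ × List ℤ),
      (l.map fun w => conjU (wordValue w.1 w.2)) = L := by
    rw [← Set.mem_range, Set.range_list_map]
    intro A hA
    obtain ⟨c, rfl⟩ := isConj_iff.1 (hconj A hA)
    obtain ⟨i, a, h⟩ := exists_conjU_wordValue c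
    exact ⟨(i, a), h⟩
  obtain ⟨D, hD⟩ := exists_hurwitzEquiv_V_U_words l (by simpa using hL) m hm
  refine ⟨D, hD, fun A hA => hD.forall_isConj hconj A (by simp [hA]), ?_, ?_⟩
  · simp [← hD.prod_eq, mul_assoc]
  · simpa using hD.length_eq.symm

/-- Kodaira type II*: any factorization of `-VU` into conjugates of `U` has `r ≥ 8` factors and Hurwitz moves bring it to `(V, U, D₃, …, Dᵣ)` with `D₃⋯Dᵣ = -1`. -/
theorem normal_factorization_IIstar (L : List SL2Z)
    (hconj : ∀ A ∈ L, IsConj U A)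
    (hprod : L.prod = -(V * U)) :
    8 ≤ L.length ∧
    ∃ D : List SL2Z,
      HurwitzEquiv L ([V, U] ++ D) ∧ D.prod = -(1 : SL2Z) := by
  obtain ⟨D, hD, hDconj, hDprod, hDlen⟩ := exists_hurwitzEquiv_V_U (m := 1)
    (by rintro rfl; revert hprod; decide) hconj (Or.inl (by rw [hprod, zpow_one]; rfl))
  rw [hprod, show (V * U)⁻¹ * -(V * U) = -1 by decide] at hDprod
  obtain ⟨D₂, -, hD₂conj, hD₂prod, hD₂len⟩ := exists_hurwitzEquiv_V_U (m := 0)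
    (by rintro rfl; revert hDprod; decide) hDconj (Or.inr (by rw [hDprod]; rfl))
  obtain ⟨D₃, -, hD₃conj, hD₃prod, hD₃len⟩ := exists_hurwitzEquiv_V_U (m := -1)
    (by rintro rfl; rw [hDprod] at hD₂prod; revert hD₂prod; decide) hD₂conj
    (Or.inl (by rw [hD₂prod, hDprod]; decide))
  obtain ⟨D₄, -, -, -, hD₄len⟩ := exists_hurwitzEquiv_V_U (m := -2)
    (by rintro rfl; rw [hD₂prod, hDprod] at hD₃prod; revert hD₃prod; decide) hD₃conj
    (Or.inr (by rw [hD₃prod, hD₂prod, hDprod]; decide))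
  exact ⟨by omega, D, hD, hDprod⟩
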